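/- Let Γ be a vertex-primitive digraph on a finite set Ω with ∅ ≠ Γ ≠ Ω × Ω, regular of valency d. Let κ be the smallest positive integer i with Γ_i ≠ ∅, let ℓ = min{ i ≥ κ : Γ_{i+1} = ⋯ = Γ_{i+κ} = ∅ }, and let σ = ⌊(ℓ−1)/κ⌋. If σ ≥ 2, then there exists i with κ ≤ i ≤ d − 1 such that Γ_i ≠ ∅ and every vertex v satisfies 1 ≤ |Γ_i(v)| ≤ 4κ − 2. -/

import Mathlib

/-- The neighbourhood of a vertex `v` in a digraph `Γ ⊆ Ω × Ω`. -/
def nbhd {Ω : Type*} (Γ : Set (Ω × Ω)) (v : Ω) : Set Ω := {u | (v, u) ∈ Γ}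

/-- The automorphism group of a digraph `Γ`, as a subgroup of `Equiv.Perm Ω`. -/
def digraphAut {Ω : Type*} (Γ : Set (Ω × Ω)) : Subgroup (Equiv.Perm Ω) where
  carrier := {g | ∀ u v : Ω, (u, v) ∈ Γ ↔ (g u, g v) ∈ Γ}
  one_mem' := fun _ _ => Iff.rfl
  mul_mem' := fun ha hb u v => (hb u v).trans (ha _ _)
  inv_mem' := by
    intro a ha u v
    simpa using (ha (a⁻¹ u) (a⁻¹ v)).symm

/-- A permutation group `G ≤ Sym(Ω)` is primitive if it is transitive and
every block is trivial (a subsingleton or the whole set). -/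
def IsPrimitiveSubgroup {Ω : Type*} (G : Subgroup (Equiv.Perm Ω)) : Prop :=
  MulAction.IsPretransitive G Ω ∧
    ∀ B : Set Ω, MulAction.IsBlock G B → B.Subsingleton ∨ B = Set.univ

/-- A digraph is vertex-primitive if its automorphism group is primitive. -/
def VertexPrimitive {Ω : Type*} (Γ : Set (Ω × Ω)) : Prop :=
  IsPrimitiveSubgroup (digraphAut Γ)

/-- `Γ_i`: the pairs of vertices whose neighbourhoods meet in exactly `d - i` points. -/
def GammaI {Ω : Type*} (Γ : Set (Ω × Ω)) (d i : ℕ) : Set (Ω × Ω) :=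
  {p | (nbhd Γ p.1 ∩ nbhd Γ p.2).ncard + i = d}

/-- The cardinality of a set as a sum of indicators. -/
lemma ncard_eq_sum_ite {Ω : Type*} [Fintype Ω] (S : Set Ω) [DecidablePred (· ∈ S)] :
    S.ncard = ∑ x, if x ∈ S then 1 else 0 := by
  rw [Set.ncard_eq_toFinset_card', Finset.sum_boole, Nat.cast_id]
  congr 1
  ext x
  simp

lemma nbhd_apply_eq_image {Ω : Type*} {R : Set (Ω × Ω)} {g : Equiv.Perm Ω}
    (hg : ∀ u v, (u, v) ∈ R ↔ (g u, g v) ∈ R) (v : Ω) :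
    nbhd R (g v) = g '' nbhd R v := by
  ext x
  simp only [nbhd, Set.mem_ofPred_eq, Set.mem_image]
  constructor
  · intro h
    exact ⟨g.symm x, (hg _ _).2 (by simpa using h), by simp⟩
  · rintro ⟨y, hy, rfl⟩
    exact (hg _ _).1 hy

lemma ncard_nbhd_apply {Ω : Type*} {R : Set (Ω × Ω)} {g : Equiv.Perm Ω}
    (hg : ∀ u v, (u, v) ∈ R ↔ (g u, g v) ∈ R) (v : Ω) :
    (nbhd R (g v)).ncard = (nbhd R v).ncard := by
  rw [nbhd_apply_eq_image hg, Set.ncard_image_of_injective _ g.injective]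

lemma mem_GammaI_apply_iff {Ω : Type*} {Γ : Set (Ω × Ω)} {g : Equiv.Perm Ω}
    (hg : g ∈ digraphAut Γ) (d i : ℕ) (u v : Ω) :
    (u, v) ∈ GammaI Γ d i ↔ (g u, g v) ∈ GammaI Γ d i := by
  have hg' : ∀ u v, (u, v) ∈ Γ ↔ (g u, g v) ∈ Γ := hg
  simp only [GammaI, Set.mem_ofPred_eq]
  rw [nbhd_apply_eq_image hg', nbhd_apply_eq_image hg', ← Set.image_inter g.injective,
    Set.ncard_image_of_injective _ g.injective]

lemma mem_GammaI_swap {Ω : Type*} {Γ : Set (Ω × Ω)} {d i : ℕ} {u v : Ω}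
    (h : (u, v) ∈ GammaI Γ d i) : (v, u) ∈ GammaI Γ d i := by
  simp only [GammaI, Set.mem_ofPred_eq] at h ⊢
  rwa [Set.inter_comm]

/-- A symmetric relation invariant under a primitive group and containing a non-diagonal pair
is connected. -/
lemma IsPrimitiveSubgroup.reflTransGen {Ω : Type*} {G : Subgroup (Equiv.Perm Ω)}
    (hG : IsPrimitiveSubgroup G) {r : Ω → Ω → Prop}
    (hr : ∀ g ∈ G, ∀ u v, r u v → r (g u) (g v)) (hsymm : ∀ u v, r u v → r v u)
    {a b : Ω} (hab : r a b) (hne : a ≠ b) (u v : Ω) : Relation.ReflTransGen r u v := by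
  have : Std.Symm r := ⟨hsymm⟩
  have symm : ∀ {x y}, Relation.ReflTransGen r x y → Relation.ReflTransGen r y x :=
    fun h => Relation.ReflTransGen.stdSymm.symm _ _ h
  have hmap : ∀ g ∈ G, ∀ {x y}, Relation.ReflTransGen r x y →
      Relation.ReflTransGen r (g x) (g y) :=
    fun g hg x y h => Relation.ReflTransGen.lift g (hr g hg) _ _ h
  have key : ∀ w, Relation.ReflTransGen r a w := by
    have hB : MulAction.IsBlock G {w | Relation.ReflTransGen r a w} := by
      rw [MulAction.isBlock_iff_smul_eq_of_mem]
      rintro g x hx hgx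
      have hax : Relation.ReflTransGen r a x := hx
      have hagx : Relation.ReflTransGen r a ((g : Equiv.Perm Ω) x) := hgx
      have haga : Relation.ReflTransGen r a ((g : Equiv.Perm Ω) a) :=
        hagx.trans (symm (hmap g g.2 hax))
      ext w
      rw [Set.mem_smul_set_iff_inv_smul_mem]
      change Relation.ReflTransGen r a ((g : Equiv.Perm Ω)⁻¹ w) ↔ Relation.ReflTransGen r a w
      constructor
      · intro h
        have := hmap g g.2 h
        rw [Equiv.Perm.inv_def, Equiv.apply_symm_apply] at this
        exact haga.trans this
      · intro h
        have := hmap _ (inv_mem g.2) ((symm haga).trans h)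
        rwa [Equiv.Perm.inv_def, Equiv.symm_apply_apply] at this
    rcases hG.2 _ hB with h | h
    · exact absurd (h (Relation.ReflTransGen.refl : Relation.ReflTransGen r a a)
        (Relation.ReflTransGen.single hab : Relation.ReflTransGen r a b)) hne
    · intro w
      have : w ∈ {w | Relation.ReflTransGen r a w} := h ▸ Set.mem_univ w
      exact this
  exact (symm (key u)).trans (key v)

section Regular

variable {Ω : Type*} [Fintype Ω] {Γ : Set (Ω × Ω)} {d : ℕ}

lemma ncard_inter_add_ncard_diff (hreg : ∀ v, (nbhd Γ v).ncard = d) (u v : Ω) :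
    (nbhd Γ u ∩ nbhd Γ v).ncard + (nbhd Γ u \ nbhd Γ v).ncard = d := by
  rw [Set.ncard_inter_add_ncard_sdiff_eq_ncard _ _ (Set.toFinite _), hreg]

lemma mem_GammaI_iff (hreg : ∀ v, (nbhd Γ v).ncard = d) {i : ℕ} {u v : Ω} :
    (u, v) ∈ GammaI Γ d i ↔ (nbhd Γ u \ nbhd Γ v).ncard = i := by
  have := ncard_inter_add_ncard_diff hreg u v
  simp only [GammaI, Set.mem_ofPred_eq]
  omega

lemma ncard_nbhd_diff_triangle (u v w : Ω) :
    (nbhd Γ u \ nbhd Γ w).ncard ≤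
      (nbhd Γ u \ nbhd Γ v).ncard + (nbhd Γ v \ nbhd Γ w).ncard := by
  refine (Set.ncard_le_ncard ?_ (Set.toFinite _)).trans (Set.ncard_union_le _ _)
  rintro x ⟨hx, hxw⟩
  by_cases hxv : x ∈ nbhd Γ v
  · exact Or.inr ⟨hxv, hxw⟩
  · exact Or.inl ⟨hx, hxv⟩

/-- In a vertex-transitive digraph of valency `d`, every vertex has in-valency `d`. -/
lemma ncard_inNbhd (hprim : VertexPrimitive Γ) (hreg : ∀ v, (nbhd Γ v).ncard = d) (x : Ω) :
    {w | (w, x) ∈ Γ}.ncard = d := by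
  classical
  have hconst : ∀ y, {w | (w, y) ∈ Γ}.ncard = {w | (w, x) ∈ Γ}.ncard := by
    intro y
    obtain ⟨g, hg⟩ := hprim.1.exists_smul_eq x y
    have hg' : ∀ u v, (u, v) ∈ Γ ↔ ((g : Equiv.Perm Ω) u, (g : Equiv.Perm Ω) v) ∈ Γ := g.2
    have := ncard_nbhd_apply (R := {p | (p.2, p.1) ∈ Γ}) (g := g) (fun u v => hg' v u) x
    rw [← hg]
    exact this
  have h1 : ∑ v : Ω, (nbhd Γ v).ncard = ∑ y : Ω, {w | (w, y) ∈ Γ}.ncard := by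
    simp only [ncard_eq_sum_ite, nbhd, Set.mem_ofPred_eq]
    exact Finset.sum_comm
  simp only [hreg, hconst, Finset.sum_const, smul_eq_mul, Finset.card_univ] at h1
  have hpos : 0 < Fintype.card Ω := Fintype.card_pos_iff.2 ⟨x⟩
  exact (Nat.eq_of_mul_eq_mul_left hpos h1).symm

lemma sum_ncard_nbhd_inter (hprim : VertexPrimitive Γ) (hreg : ∀ v, (nbhd Γ v).ncard = d)
    (v : Ω) : ∑ w, (nbhd Γ v ∩ nbhd Γ w).ncard = d * d := by
  classical
  have h : ∀ w, (nbhd Γ v ∩ nbhd Γ w).ncard =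
      ∑ x, (if x ∈ nbhd Γ v then 1 else 0) * (if (w, x) ∈ Γ then 1 else 0) := by
    intro w
    rw [ncard_eq_sum_ite]
    refine Finset.sum_congr rfl fun x _ => ?_
    by_cases h1 : (v, x) ∈ Γ <;> by_cases h2 : (w, x) ∈ Γ <;> simp [h1, h2, nbhd]
  simp only [h]
  rw [Finset.sum_comm]
  have h3 : ∀ x, ∑ w, (if (w, x) ∈ Γ then 1 else 0) = d := by
    intro x
    rw [← ncard_inNbhd hprim hreg x, ncard_eq_sum_ite]
    simp only [Set.mem_ofPred_eq]
  simp only [← Finset.mul_sum, h3]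
  rw [← Finset.sum_mul, ← ncard_eq_sum_ite, hreg]

/-- If no `Γ_j` with `ℓ < j ≤ ℓ + κ` has a pair, then no `Γ_j` with `ℓ < j` has one. -/
lemma ncard_nbhd_diff_le (hprim : VertexPrimitive Γ) (hreg : ∀ v, (nbhd Γ v).ncard = d)
    {κ ℓ : ℕ} (hκpos : 0 < κ) (hκne : GammaI Γ d κ ≠ ∅)
    (hℓgap : ∀ j : ℕ, ℓ + 1 ≤ j → j ≤ ℓ + κ → GammaI Γ d j = ∅) (u v : Ω) :
    (nbhd Γ u \ nbhd Γ v).ncard ≤ ℓ := by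
  obtain ⟨⟨a, b⟩, hab⟩ := Set.nonempty_iff_ne_empty.2 hκne
  have hne : a ≠ b := by
    rintro rfl
    rw [mem_GammaI_iff hreg] at hab
    simp at hab
    omega
  have hconn := IsPrimitiveSubgroup.reflTransGen hprim
    (r := fun x y => (x, y) ∈ GammaI Γ d κ)
    (fun g hg x y h => (mem_GammaI_apply_iff hg d κ x y).1 h)
    (fun x y h => mem_GammaI_swap h) hab hne u v
  induction hconn with
  | refl => simp
  | @tail y z _ hyz ih =>
    by_contra hlt
    have htri := ncard_nbhd_diff_triangle (Γ := Γ) u y z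
    rw [(mem_GammaI_iff hreg).1 hyz] at htri
    have hmem : (u, z) ∈ GammaI Γ d (nbhd Γ u \ nbhd Γ z).ncard := (mem_GammaI_iff hreg).2 rfl
    rw [hℓgap _ (by omega) (by omega)] at hmem
    exact hmem

/-- The total defect `∑ w, (ℓ - |Γ(v) \ Γ(w)|)` is at most `ℓ ^ 2` when `ℓ` is
attained as some `|Γ(a) \ Γ(b)|`. -/
lemma sum_sub_ncard_nbhd_diff_le (hprim : VertexPrimitive Γ)
    (hreg : ∀ v, (nbhd Γ v).ncard = d) {ℓ : ℕ} {a b : Ω}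
    (hab : (nbhd Γ a \ nbhd Γ b).ncard = ℓ) (v : Ω) :
    ∑ w, ((ℓ : ℤ) - (nbhd Γ v \ nbhd Γ w).ncard) ≤ (ℓ : ℤ) * ℓ := by
  have h1 : ℓ ≤ d := by
    have := ncard_inter_add_ncard_diff hreg a b
    omega
  have h2 : ℓ + d ≤ Fintype.card Ω := by
    have hdis : Disjoint (nbhd Γ a \ nbhd Γ b) (nbhd Γ b) := Set.disjoint_sdiff_left
    have := Set.ncard_union_eq hdis (Set.toFinite _) (Set.toFinite _)
    rw [hab, hreg] at this
    rw [← this, ← Nat.card_eq_fintype_card]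
    exact Set.ncard_le_card _
  have h3 : ∑ w, ((nbhd Γ v ∩ nbhd Γ w).ncard : ℤ) = d * d := by
    exact_mod_cast sum_ncard_nbhd_inter hprim hreg v
  have h4 : ∑ w, ((ℓ : ℤ) - (nbhd Γ v \ nbhd Γ w).ncard) =
      ∑ w, ((ℓ : ℤ) - d + (nbhd Γ v ∩ nbhd Γ w).ncard) := by
    refine Finset.sum_congr rfl fun w _ => ?_
    have := ncard_inter_add_ncard_diff hreg v w
    omega
  rw [h4, Finset.sum_add_distrib, h3, Finset.sum_const, Finset.card_univ, nsmul_eq_mul]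
  zify at h1 h2
  nlinarith [mul_nonneg (sub_nonneg.2 h1) (sub_nonneg.2 h2)]

end Regular

lemma sum_range_sub_succ_mul (ℓ κ : ℤ) (σ : ℕ) :
    2 * ∑ j ∈ Finset.range σ, (ℓ - (j + 1) * κ) = 2 * σ * ℓ - κ * σ * (σ + 1) := by
  induction σ with
  | zero => simp
  | succ n ih =>
    rw [Finset.sum_range_succ, mul_add, ih]
    push_cast
    ring

lemma mul_pred_lt_of_window {κ ℓ σ : ℕ} (hκ : 0 < κ) (hσ : 2 ≤ σ)
    (h1 : σ * κ + 1 ≤ ℓ) (h2 : ℓ ≤ (σ + 1) * κ) :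
    2 * ((ℓ : ℤ) * ℓ - ℓ) < (4 * κ - 1) * (2 * σ * ℓ - κ * σ * (σ + 1)) := by
  obtain ⟨s, rfl⟩ := Nat.exists_eq_add_of_le h1
  obtain ⟨r, rfl⟩ := Nat.exists_eq_add_of_le hσ
  obtain ⟨t, rfl⟩ : ∃ t, κ = 1 + s + t := Nat.exists_eq_add_of_le (by linarith)
  push_cast
  rw [← sub_pos]
  ring_nf
  positivity

/-- **Remark after Theorem 1.** With `κ` the smallest positive `i` with `Γ_i ≠ ∅`,
`ℓ = min { i ≥ κ : Γ_{i+1} = ⋯ = Γ_{i+κ} = ∅ }` and `σ = ⌊(ℓ-1)/κ⌋`, if `σ ≥ 2` then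
there exists `i` with `κ ≤ i ≤ d - 1` such that `Γ_i ≠ ∅` and every vertex has valency
between `1` and `4κ - 2` in `Γ_i`. -/
theorem stmt_12 {Ω : Type*} [Fintype Ω] (Γ : Set (Ω × Ω))
    (hprim : VertexPrimitive Γ) (hne : Γ ≠ ∅) (hnu : Γ ≠ Set.univ)
    (d : ℕ) (hreg : ∀ v : Ω, (nbhd Γ v).ncard = d)
    (κ : ℕ) (hκpos : 0 < κ) (hκne : GammaI Γ d κ ≠ ∅)
    (hκmin : ∀ j : ℕ, 0 < j → j < κ → GammaI Γ d j = ∅)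
    (ℓ : ℕ) (hℓκ : κ ≤ ℓ)
    (hℓgap : ∀ j : ℕ, ℓ + 1 ≤ j → j ≤ ℓ + κ → GammaI Γ d j = ∅)
    (hℓmin : ∀ m : ℕ, κ ≤ m → (∀ j : ℕ, m + 1 ≤ j → j ≤ m + κ → GammaI Γ d j = ∅) →
      ℓ ≤ m)
    (σ : ℕ) (hσ : σ = (ℓ - 1) / κ) (hσ2 : 2 ≤ σ) :
    ∃ i : ℕ, κ ≤ i ∧ i ≤ d - 1 ∧ GammaI Γ d i ≠ ∅ ∧
      ∀ v : Ω, 1 ≤ (nbhd (GammaI Γ d i) v).ncard ∧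
        (nbhd (GammaI Γ d i) v).ncard ≤ 4 * κ - 2 := by
  classical
  have hσℓ : σ * κ + 1 ≤ ℓ := by
    have := Nat.div_mul_le_self (ℓ - 1) κ
    have hpos : 0 < σ * κ := by positivity
    rw [← hσ] at this
    omega
  have hℓσ : ℓ ≤ (σ + 1) * κ := by
    have := Nat.lt_div_mul_add (a := ℓ - 1) hκpos
    rw [← hσ] at this
    rw [add_mul, one_mul]
    omega
  have hκℓ : κ < ℓ := by nlinarith
  have hDle := ncard_nbhd_diff_le hprim hreg hκpos hκne hℓgap
  have hpresent : ∀ m, κ ≤ m → m < ℓ → ∃ j, m < j ∧ j ≤ m + κ ∧ GammaI Γ d j ≠ ∅ := by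
    intro m hm hmℓ
    by_contra! hcon
    exact absurd (hℓmin m hm fun j hj hj' => hcon j hj hj') (by omega)
  obtain ⟨a, b, hab⟩ : ∃ a b, (nbhd Γ a \ nbhd Γ b).ncard = ℓ := by
    obtain ⟨j, hj, hjκ, hjne⟩ := hpresent (ℓ - 1) (by omega) (by omega)
    obtain ⟨⟨a, b⟩, hab⟩ := Set.nonempty_iff_ne_empty.2 hjne
    rw [mem_GammaI_iff hreg] at hab
    have := hDle a b
    exact ⟨a, b, by omega⟩
  have hℓd : ℓ ≤ d := by
    have := ncard_inter_add_ncard_diff hreg a b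
    omega
  have hval : ∀ i (u v : Ω),
      (nbhd (GammaI Γ d i) u).ncard = (nbhd (GammaI Γ d i) v).ncard := by
    intro i u v
    obtain ⟨g, hg⟩ := hprim.1.exists_smul_eq v u
    rw [← hg]
    have hinv : ∀ x y, (x, y) ∈ GammaI Γ d i ↔
        ((g : Equiv.Perm Ω) x, (g : Equiv.Perm Ω) y) ∈ GammaI Γ d i :=
      fun x y => mem_GammaI_apply_iff g.2 d i x y
    exact ncard_nbhd_apply hinv v
  by_contra! hcon
  have hbig : ∀ i, κ ≤ i → i < ℓ → GammaI Γ d i ≠ ∅ →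
      4 * κ - 1 ≤ (nbhd (GammaI Γ d i) a).ncard := by
    intro i hi hiℓ hine
    obtain ⟨v, hv⟩ := hcon i hi (by omega) (Set.nonempty_iff_ne_empty.2 hine)
    obtain ⟨⟨x, y⟩, hxy⟩ := Set.nonempty_iff_ne_empty.2 hine
    have hpos : 0 < (nbhd (GammaI Γ d i) x).ncard :=
      (Set.ncard_pos (Set.toFinite _)).2 ⟨y, hxy⟩
    rw [hval i x v] at hpos
    have := hv hpos
    rw [hval i a v]
    omega
  have hwindow : ∀ j, ∃ i, j < σ →
      j * κ < i ∧ i ≤ (j + 1) * κ ∧ κ ≤ i ∧ i < ℓ ∧ GammaI Γ d i ≠ ∅ := by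
    intro j
    rcases Nat.eq_zero_or_pos j with rfl | hj
    · exact ⟨κ, fun _ => ⟨by simpa using hκpos, by simp, le_rfl, hκℓ, hκne⟩⟩
    · by_cases hjσ : j < σ
      · have hle : (j + 1) * κ ≤ σ * κ := Nat.mul_le_mul_right _ hjσ
        have hκj : κ ≤ j * κ := Nat.le_mul_of_pos_left _ hj
        rw [add_mul, one_mul] at hle
        obtain ⟨i, hi, hi', hine⟩ := hpresent (j * κ) hκj (by omega)
        refine ⟨i, fun _ => ⟨hi, ?_, by omega, by omega, hine⟩⟩
        rwa [add_mul, one_mul]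
      · exact ⟨0, fun h => absurd h hjσ⟩
  choose i hi using hwindow
  let S : ℕ → Finset Ω := fun j => {w | (nbhd Γ a \ nbhd Γ w).ncard = i j}
  have hScard : ∀ j, (S j).card = (nbhd (GammaI Γ d (i j)) a).ncard := by
    intro j
    rw [← Set.ncard_coe_finset]
    congr 1
    ext w
    simp only [S, Finset.mem_coe, Finset.mem_filter, Finset.mem_univ, true_and]
    exact (mem_GammaI_iff hreg).symm
  have hdisj : Set.PairwiseDisjoint (Finset.range σ : Set ℕ) S := by
    have hlt : ∀ j k, j < k → k < σ → i j < i k := by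
      intro j k hjk hk
      have h1 := (hi j (hjk.trans hk)).2.1
      have h2 := (hi k hk).1
      have h3 : (j + 1) * κ ≤ k * κ := Nat.mul_le_mul_right _ hjk
      omega
    intro j hj k hk hjk
    simp only [Finset.coe_range, Set.mem_Iio] at hj hk
    refine Finset.disjoint_left.2 fun w hwj hwk => ?_
    simp only [S, Finset.mem_filter, Finset.mem_univ, true_and] at hwj hwk
    rcases Nat.lt_or_gt_of_ne hjk with h | h
    · have := hlt j k h hk
      omega
    · have := hlt k j h hj
      omega
  have ha : a ∉ (Finset.range σ).biUnion S := by
    simp only [S, Finset.mem_biUnion, Finset.mem_range, Finset.mem_filter, Finset.mem_univ,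
      true_and, sdiff_self, Set.bot_eq_empty, Set.ncard_empty, not_exists, not_and]
    intro j hj h
    have := (hi j hj).2.2.1
    omega
  have hlower : (ℓ : ℤ) + (4 * κ - 1) * ∑ j ∈ Finset.range σ, ((ℓ : ℤ) - (j + 1) * κ) ≤
      ∑ w, ((ℓ : ℤ) - (nbhd Γ a \ nbhd Γ w).ncard) := by
    calc
      _ ≤ (ℓ : ℤ) + ∑ j ∈ Finset.range σ, ∑ w ∈ S j,
            ((ℓ : ℤ) - (nbhd Γ a \ nbhd Γ w).ncard) := by
        rw [Finset.mul_sum]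
        gcongr with j hj
        obtain ⟨-, h2, h3, h4, h5⟩ := hi j (Finset.mem_range.1 hj)
        have hsum : ∑ w ∈ S j, ((ℓ : ℤ) - (nbhd Γ a \ nbhd Γ w).ncard) =
            (S j).card * ((ℓ : ℤ) - i j) := by
          rw [← nsmul_eq_mul, ← Finset.sum_const]
          refine Finset.sum_congr rfl fun w hw => ?_
          simp only [S, Finset.mem_filter, Finset.mem_univ, true_and] at hw
          rw [hw]
        rw [hsum, hScard]
        have hb := hbig (i j) h3 h4 h5
        have hb' : (4 * κ - 1 : ℤ) ≤ (nbhd (GammaI Γ d (i j)) a).ncard := by omega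
        have h2' : (i j : ℤ) ≤ (j + 1) * κ := by exact_mod_cast h2
        have h4' : (0 : ℤ) ≤ ℓ - i j := by omega
        have hκ' : (0 : ℤ) ≤ 4 * κ - 1 := by omega
        calc
          _ ≤ (4 * κ - 1 : ℤ) * (ℓ - i j) := mul_le_mul_of_nonneg_left (by linarith) hκ'
          _ ≤ _ := mul_le_mul_of_nonneg_right hb' h4'
      _ = ∑ w ∈ insert a ((Finset.range σ).biUnion S),
            ((ℓ : ℤ) - (nbhd Γ a \ nbhd Γ w).ncard) := by
        rw [Finset.sum_insert ha, Finset.sum_biUnion hdisj]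
        simp
      _ ≤ _ := by
        refine Finset.sum_le_sum_of_subset_of_nonneg (Finset.subset_univ _) fun w _ _ => ?_
        have := hDle a w
        omega
  have hupper := sum_sub_ncard_nbhd_diff_le hprim hreg hab a
  have hnum := mul_pred_lt_of_window hκpos hσ2 hσℓ hℓσ
  rw [← sum_range_sub_succ_mul] at hnum
  linarith
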